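/- In the high-temperature regime β < 1, the SK model free energy equals the annealed value: lim_{N→∞} (1/N) E[log Z_N^{SK}] = log 2 + β²/4, where couplings are centered Gaussians. -/

import Mathlib

open MeasureTheory ProbabilityTheory Filter Topology

/-- The Ising spin value of a configuration at a site. -/
noncomputable def spin {N : ℕ} (σ : Fin N → Bool) (i : Fin N) : ℝ :=
  if σ i then 1 else -1

/-- The Gaussian product measure. -/
noncomputable abbrev gpi (ι : Type) [Fintype ι] : Measure (ι → ℝ) :=
  Measure.pi fun _ : ι => gaussianReal 0 1

/-- Coordinatewise Lipschitz. -/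
def L1Lip {ι : Type} [Fintype ι] (c : ℝ) (F : (ι → ℝ) → ℝ) : Prop :=
  ∀ x y, |F x - F y| ≤ c * ∑ i, |x i - y i|

lemma L1Lip.continuous {ι : Type} [Fintype ι] {c : ℝ} {F : (ι → ℝ) → ℝ} (h : L1Lip c F) :
    Continuous F := by
  rw [continuous_iff_continuousAt]
  intro y
  rw [ContinuousAt, tendsto_iff_dist_tendsto_zero]
  have h1 : Tendsto (fun x : ι → ℝ => c * ∑ i, |x i - y i|) (𝓝 y) (𝓝 0) := by
    have : Continuous (fun x : ι → ℝ => c * ∑ i, |x i - y i|) := by fun_prop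
    simpa using this.tendsto y
  exact squeeze_zero (fun _ => dist_nonneg) (fun x => by rw [Real.dist_eq]; exact h x y) h1

lemma memLp_coord {ι : Type} [Fintype ι] (i : ι) :
    MemLp (fun x : ι → ℝ => x i) 2 (gpi ι) := by
  have h := measurePreserving_eval (fun _ : ι => gaussianReal 0 1) i
  have := (memLp_id_gaussianReal' (μ := 0) (v := 1) 2 (by simp)).comp_measurePreserving h
  exact this

lemma L1Lip.memLp {ι : Type} [Fintype ι] {c : ℝ} {F : (ι → ℝ) → ℝ} (h : L1Lip c F) :
    MemLp F 2 (gpi ι) := by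
  have h1 : MemLp (fun x : ι → ℝ => |F 0| + c * ∑ i, |x i|) 2 (gpi ι) := by
    have h0 : MemLp (fun x : ι → ℝ => ∑ i, |x i|) 2 (gpi ι) :=
      memLp_finsetSum (f := fun (i : ι) (x : ι → ℝ) => |x i|) Finset.univ
        fun i _ => (memLp_coord i).norm
    have h2 : MemLp (fun _ : ι → ℝ => |F 0|) 2 (gpi ι) := memLp_const _
    exact h2.add (h0.const_mul c)
  refine h1.mono' h.continuous.aestronglyMeasurable (ae_of_all _ fun x => ?_)
  have := h x 0
  simp only [Pi.zero_apply, sub_zero] at this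
  rw [Real.norm_eq_abs]
  have h3 := abs_sub_abs_le_abs_sub (F x) (F 0)
  linarith

lemma var_one {c : ℝ} {f : ℝ → ℝ} (hf : ∀ x y, |f x - f y| ≤ c * |x - y|)
    (hm : AEStronglyMeasurable f (gaussianReal 0 1)) : Var[f; gaussianReal 0 1] ≤ c ^ 2 := by
  rw [← variance_sub_const hm (f 0)]
  refine (variance_le_expectation_sq (hm.sub aestronglyMeasurable_const)).trans ?_
  have hi : Integrable (fun x : ℝ => c ^ 2 * x ^ 2) (gaussianReal 0 1) :=
    (memLp_id_gaussianReal' (μ := 0) (v := 1) 2 (by simp)).integrable_sq.const_mul _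
  have hv : ∫ x : ℝ, x ^ 2 ∂(gaussianReal 0 1) = 1 := by
    have := variance_fun_id_gaussianReal (μ := 0) (v := 1)
    rw [variance_eq_integral measurable_id'.aemeasurable] at this
    simpa using this
  have : ∫ x : ℝ, c ^ 2 * x ^ 2 ∂(gaussianReal 0 1) = c ^ 2 := by
    rw [integral_const_mul, hv, mul_one]
  rw [← this]
  refine integral_mono_of_nonneg (ae_of_all _ fun x => sq_nonneg _) hi (ae_of_all _ fun x => ?_)
  have h1 := hf x 0
  simp only [Pi.pow_apply, sub_zero] at h1 ⊢
  calc (f x - f 0) ^ 2 = |f x - f 0| ^ 2 := (sq_abs _).symm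
    _ ≤ (c * |x|) ^ 2 := by gcongr
    _ = c ^ 2 * x ^ 2 := by rw [mul_pow, sq_abs]

lemma var_fin {c : ℝ} : ∀ (n : ℕ) (F : (Fin n → ℝ) → ℝ), L1Lip c F →
    Var[F; gpi (Fin n)] ≤ n * c ^ 2 := by
  intro n
  induction n with
  | zero =>
    intro F hF
    have : F = fun _ => F 0 := by ext x; rw [Subsingleton.elim x 0]
    rw [this, variance_eq_integral (by fun_prop)]
    simp
  | succ n ih =>
    intro F hF
    have hmp := (measurePreserving_piFinSuccAbove (fun _ : Fin (n + 1) => gaussianReal 0 1) 0).symm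
    set e := (MeasurableEquiv.piFinSuccAbove (fun _ : Fin (n+1) => ℝ) 0).symm with he
    have hsum : ∀ t s (x y : Fin n → ℝ), ∑ i, |e (t, x) i - e (s, y) i|
        = |t - s| + ∑ i, |x i - y i| := by
      intro t s x y
      rw [Fin.sum_univ_succ]
      simp [he, MeasurableEquiv.piFinSuccAbove, Fin.insertNthEquiv]
    have hL : MemLp (fun p => F (e p)) 2 ((gaussianReal 0 1).prod (gpi (Fin n))) :=
      hF.memLp.comp_measurePreserving hmp
    have hvar : Var[F; gpi (Fin (n+1))]
        = Var[fun p => F (e p); (gaussianReal 0 1).prod (gpi (Fin n))] := by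
      rw [show gpi (Fin (n+1)) = _ from hmp.map_eq.symm, variance_map _ hmp.measurable.aemeasurable]
      · rfl
      · exact hF.continuous.aemeasurable
    have hcont : ∀ x, Measurable fun t => F (e (t, x)) := fun x =>
      hF.continuous.measurable.comp (e.measurable.comp measurable_prodMk_right)
    have hone : ∀ (x : Fin n → ℝ) t s, |F (e (t, x)) - F (e (s, x))| ≤ c * |t - s| := by
      intro x t s
      have := hF (e (t, x)) (e (s, x))
      rw [hsum] at this
      simpa using this
    have hmem : ∀ x, MemLp (fun t => F (e (t, x))) 2 (gaussianReal 0 1) := by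
      intro x
      have h1 : MemLp (fun t : ℝ => |F (e (0, x))| + c * |t|) 2 (gaussianReal 0 1) := by
        have h0 : MemLp (fun t : ℝ => |t|) 2 (gaussianReal 0 1) :=
          (memLp_id_gaussianReal' (μ := 0) (v := 1) 2 (by simp)).norm
        have h2 : MemLp (fun _ : ℝ => |F (e (0, x))|) 2 (gaussianReal 0 1) := memLp_const _
        exact h2.add (h0.const_mul c)
      refine h1.mono' (hcont x).aestronglyMeasurable (ae_of_all _ fun t => ?_)
      have := hone x t 0
      simp only [sub_zero] at this
      rw [Real.norm_eq_abs]
      have h3 := abs_sub_abs_le_abs_sub (F (e (t, x))) (F (e (0, x)))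
      linarith
    have hint : ∀ x, Integrable (fun t => F (e (t, x))) (gaussianReal 0 1) := fun x =>
      (hmem x).integrable (by norm_num)
    set G : (Fin n → ℝ) → ℝ := fun x => ∫ t, F (e (t, x)) ∂(gaussianReal 0 1) with hG
    have hGL : L1Lip c G := by
      intro x y
      rw [hG]
      simp only
      rw [← integral_sub (hint x) (hint y), ← Real.norm_eq_abs]
      refine (norm_integral_le_of_norm_le_const (C := c * ∑ i, |x i - y i|)
        (ae_of_all _ fun t => ?_)).trans (by simp)
      have := hF (e (t, x)) (e (t, y))
      rw [hsum] at this
      simpa using this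
    have hG2 := ih G hGL
    rw [hvar, variance_eq_sub hL]
    rw [variance_eq_sub hGL.memLp] at hG2
    have hmean : ∫ p, F (e p) ∂((gaussianReal 0 1).prod (gpi (Fin n))) = ∫ x, G x ∂(gpi (Fin n)) :=
      integral_prod_symm _ (hL.integrable (by norm_num))
    have hsq : ∫ p, ((fun p => F (e p)) ^ 2) p ∂((gaussianReal 0 1).prod (gpi (Fin n)))
        ≤ c ^ 2 + ∫ x, (G ^ 2) x ∂(gpi (Fin n)) := by
      simp only [Pi.pow_apply]
      rw [integral_prod_symm _ hL.integrable_sq]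
      have hGi : Integrable (fun x => c ^ 2 + G x ^ 2) (gpi (Fin n)) :=
        (integrable_const _).add hGL.memLp.integrable_sq
      have : c ^ 2 + ∫ x, G x ^ 2 ∂(gpi (Fin n)) = ∫ x, (c ^ 2 + G x ^ 2) ∂(gpi (Fin n)) := by
        rw [integral_add (integrable_const _) hGL.memLp.integrable_sq]; simp
      rw [this]
      refine integral_mono_of_nonneg (ae_of_all _ fun x => integral_nonneg fun t => sq_nonneg _) hGi
        (ae_of_all _ fun x => ?_)
      have h1 := var_one (hone x) (hcont x).aestronglyMeasurable
      rw [variance_eq_sub (hmem x)] at h1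
      simp only [Pi.pow_apply] at h1 ⊢
      change _ - (G x) ^ 2 ≤ _ at h1
      linarith
    rw [hmean]
    push_cast
    linarith

lemma var_gen {ι : Type} [Fintype ι] {c : ℝ} (F : (ι → ℝ) → ℝ) (hF : L1Lip c F) :
    Var[F; gpi ι] ≤ Fintype.card ι * c ^ 2 := by
  have hmp := measurePreserving_piCongrLeft (fun _ : ι => gaussianReal 0 1)
    (Fintype.equivFin ι).symm
  set e := MeasurableEquiv.piCongrLeft (fun _ : ι => ℝ) (Fintype.equivFin ι).symm with he
  rw [show gpi ι = _ from hmp.map_eq.symm, variance_map hF.continuous.aemeasurable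
    hmp.measurable.aemeasurable]
  refine var_fin _ _ fun x y => ?_
  refine (hF _ _).trans (le_of_eq ?_)
  congr 1
  rw [← (Fintype.equivFin ι).symm.sum_comp]
  simp [he, MeasurableEquiv.coe_piCongrLeft, Equiv.piCongrLeft_apply_apply]

lemma lip_logsum {ι S : Type} [Fintype ι] [Fintype S] [Nonempty S] {c : ℝ} (a : S → ι → ℝ)
    (ha : ∀ s p, |a s p| ≤ c) :
    L1Lip c (fun x => Real.log (∑ s, Real.exp (∑ p, a s p * x p))) := by
  have key : ∀ x y : ι → ℝ, Real.log (∑ s, Real.exp (∑ p, a s p * x p))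
      ≤ Real.log (∑ s, Real.exp (∑ p, a s p * y p)) + c * ∑ i, |x i - y i| := by
    intro x y
    have hpos : ∀ z : ι → ℝ, 0 < ∑ s, Real.exp (∑ p, a s p * z p) := fun z =>
      Finset.sum_pos (fun _ _ => Real.exp_pos _) Finset.univ_nonempty
    rw [← Real.log_exp (c * ∑ i, |x i - y i|), ← Real.log_mul (hpos y).ne' (Real.exp_pos _).ne']
    refine Real.log_le_log (hpos x) ?_
    rw [Finset.sum_mul]
    refine Finset.sum_le_sum fun s _ => ?_
    rw [← Real.exp_add, Real.exp_le_exp, Finset.mul_sum, ← Finset.sum_add_distrib]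
    refine Finset.sum_le_sum fun p _ => ?_
    have h1 : a s p * (x p - y p) ≤ c * |x p - y p| :=
      (le_abs_self _).trans (by rw [abs_mul]; exact mul_le_mul_of_nonneg_right (ha s p) (abs_nonneg _))
    linarith
  intro x y
  have h1 := key x y
  have h2 := key y x
  simp_rw [abs_sub_comm (y _) (x _)] at h2
  rw [abs_le]
  constructor <;> linarith

lemma gauss_exp_int {ι : Type} [Fintype ι] (b : ι → ℝ) :
    Integrable (fun x : ι → ℝ => Real.exp (∑ p, b p * x p)) (gpi ι) := by
  simp_rw [Real.exp_sum]
  exact Integrable.fintype_prod (f := fun p (t : ℝ) => Real.exp (b p * t))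
    fun p => integrable_exp_mul_gaussianReal (b p)

lemma gauss_exp {ι : Type} [Fintype ι] (b : ι → ℝ) :
    ∫ x, Real.exp (∑ p, b p * x p) ∂(gpi ι) = Real.exp ((∑ p, b p ^ 2) / 2) := by
  simp_rw [Real.exp_sum]
  rw [integral_fintype_prod_eq_prod (f := fun p (t : ℝ) => Real.exp (b p * t)), Finset.sum_div,
    Real.exp_sum]
  refine Finset.prod_congr rfl fun p _ => ?_
  have := congrFun (mgf_fun_id_gaussianReal (μ := 0) (v := 1)) (b p)
  simp only [mgf] at this
  rw [this]
  simp

lemma lower_abs {Ω : Type} [MeasurableSpace Ω] (μ : Measure Ω) [IsProbabilityMeasure μ]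
    (Z : Ω → ℝ) (hZ : ∀ x, 0 < Z x) (A C V : ℝ) (hA : 0 < A) (hC : 0 < C) (hV : 0 ≤ V)
    (hZi : Integrable Z μ) (hZ2 : Integrable (fun x => Z x ^ 2) μ)
    (hL : MemLp (fun x => Real.log (Z x)) 2 μ)
    (hA1 : ∫ x, Z x ∂μ = A) (hA2 : ∫ x, Z x ^ 2 ∂μ ≤ C * A ^ 2)
    (hvar : Var[fun x => Real.log (Z x); μ] ≤ V) :
    Real.log A - Real.log 2 - 2 * Real.sqrt (C * V) ≤ ∫ x, Real.log (Z x) ∂μ := by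
  set m := ∫ x, Real.log (Z x) ∂μ with hm
  rw [variance_eq_integral hL.aemeasurable, ← hm] at hvar
  have hLi : Integrable (fun x => (Real.log (Z x) - m) ^ 2) μ := (hL.sub (memLp_const m)).integrable_sq
  have main : ∀ t : ℝ, 0 < t → 2 * Real.sqrt (C * V) ≤ t →
      Real.log A - Real.log 2 - t ≤ m := by
    intro t ht htV
    have ht2 : 4 * (C * V) ≤ t ^ 2 := by
      have := Real.sq_sqrt (mul_nonneg hC.le hV)
      have h0 := Real.sqrt_nonneg (C * V)
      nlinarith
    have hpt : ∀ x, Z x ≤ Real.exp (m + t) +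
        ((1 / (4 * C * A)) * Z x ^ 2 + (C * A / t ^ 2) * (Real.log (Z x) - m) ^ 2) := by
      intro x
      rcases le_or_gt (Real.log (Z x) - m) t with h | h
      · have : Z x ≤ Real.exp (m + t) := by
          rw [← Real.exp_log (hZ x)]
          exact Real.exp_le_exp.2 (by linarith)
        have : 0 ≤ (1 / (4 * C * A)) * Z x ^ 2 + (C * A / t ^ 2) * (Real.log (Z x) - m) ^ 2 := by
          positivity
        linarith
      · have h1 : C * A ≤ (C * A / t ^ 2) * (Real.log (Z x) - m) ^ 2 := by
          rw [div_mul_eq_mul_div, le_div_iff₀ (by positivity)]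
          gcongr
        have h2 : Z x ≤ (1 / (4 * C * A)) * Z x ^ 2 + C * A := by
          have hCA : 0 < C * A := by positivity
          have : (1 / (4 * C * A)) * Z x ^ 2 + C * A - Z x
              = (1 / (4 * C * A)) * (Z x - 2 * (C * A)) ^ 2 := by field_simp; ring
          have h3 : 0 ≤ (1 / (4 * C * A)) * (Z x - 2 * (C * A)) ^ 2 := by positivity
          linarith
        have := Real.exp_pos (m + t)
        linarith
    have hint := integral_mono hZi ((integrable_const (Real.exp (m + t))).add
      ((hZ2.const_mul (1 / (4 * C * A))).add (hLi.const_mul (C * A / t ^ 2)))) hpt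
    have hS : Integrable (fun x => (1 / (4 * C * A)) * Z x ^ 2
        + (C * A / t ^ 2) * (Real.log (Z x) - m) ^ 2) μ :=
      (hZ2.const_mul (1 / (4 * C * A))).add (hLi.const_mul (C * A / t ^ 2))
    have e1 : ∫ x, (Real.exp (m + t) +
        ((1 / (4 * C * A)) * Z x ^ 2 + (C * A / t ^ 2) * (Real.log (Z x) - m) ^ 2)) ∂μ
        = Real.exp (m + t) + ((1 / (4 * C * A)) * ∫ x, Z x ^ 2 ∂μ
          + (C * A / t ^ 2) * ∫ x, (Real.log (Z x) - m) ^ 2 ∂μ) := by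
      rw [integral_add (integrable_const _) hS,
        integral_add (hZ2.const_mul _) (hLi.const_mul _), integral_const_mul, integral_const_mul]
      simp
    have hint' : A ≤ Real.exp (m + t) + ((1 / (4 * C * A)) * ∫ x, Z x ^ 2 ∂μ
          + (C * A / t ^ 2) * ∫ x, (Real.log (Z x) - m) ^ 2 ∂μ) :=
      hA1.symm.le.trans (hint.trans e1.le)
    have b1 : (1 / (4 * C * A)) * ∫ x, Z x ^ 2 ∂μ ≤ A / 4 := by
      calc _ ≤ (1 / (4 * C * A)) * (C * A ^ 2) := by gcongr
        _ = A / 4 := by field_simp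
    have b2 : (C * A / t ^ 2) * ∫ x, (Real.log (Z x) - m) ^ 2 ∂μ ≤ A / 4 := by
      calc _ ≤ (C * A / t ^ 2) * V := by gcongr
        _ ≤ A / 4 := by
          rw [div_mul_eq_mul_div, div_le_div_iff₀ (by positivity) (by norm_num)]
          nlinarith
    have hfin : A / 2 ≤ Real.exp (m + t) := by linarith
    have := Real.log_le_log (by positivity) hfin
    rw [Real.log_exp, Real.log_div hA.ne' (by norm_num)] at this
    linarith
  refine le_of_forall_pos_le_add fun ε hε => ?_
  have := main (2 * Real.sqrt (C * V) + ε) (by positivity) (by linarith)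
  linarith

lemma upper_abs {Ω : Type} [MeasurableSpace Ω] (μ : Measure Ω) [IsProbabilityMeasure μ]
    (Z : Ω → ℝ) (hZ : ∀ x, 0 < Z x) (A : ℝ) (hA : 0 < A)
    (hZi : Integrable Z μ) (hL : Integrable (fun x => Real.log (Z x)) μ)
    (hA1 : ∫ x, Z x ∂μ = A) : ∫ x, Real.log (Z x) ∂μ ≤ Real.log A := by
  have h : ∀ x, Real.log (Z x) ≤ (Real.log A - 1) + Z x / A := by
    intro x
    have := Real.log_le_sub_one_of_pos (div_pos (hZ x) hA)
    rw [Real.log_div (hZ x).ne' hA.ne'] at this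
    linarith
  have := integral_mono hL ((integrable_const (Real.log A - 1)).add (hZi.div_const A)) h
  refine this.trans (le_of_eq ?_)
  have e : ∫ x, ((Real.log A - 1) + Z x / A) ∂μ = Real.log A := by
    rw [integral_add (integrable_const _) (hZi.div_const A), integral_div, hA1, div_self hA.ne']
    simp
  exact e

lemma gauss_bounds {ι S : Type} [Fintype ι] [Fintype S] [Nonempty S] {c v C : ℝ} (hC : 0 < C)
    (a : S → ι → ℝ) (ha : ∀ s p, |a s p| ≤ c) (hv : ∀ s, ∑ p, a s p ^ 2 = v)
    (h2 : ∑ s, ∑ t, Real.exp (∑ p, a s p * a t p) ≤ C * (Fintype.card S : ℝ) ^ 2) :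
    (∫ x, Real.log (∑ s, Real.exp (∑ p, a s p * x p)) ∂(gpi ι)
      ≤ Real.log (Fintype.card S) + v / 2) ∧
    Real.log (Fintype.card S) + v / 2 - Real.log 2
      - 2 * Real.sqrt (C * (Fintype.card ι * c ^ 2))
      ≤ ∫ x, Real.log (∑ s, Real.exp (∑ p, a s p * x p)) ∂(gpi ι) := by
  have hpos : ∀ z : ι → ℝ, 0 < ∑ s, Real.exp (∑ p, a s p * z p) := fun z =>
    Finset.sum_pos (fun _ _ => Real.exp_pos _) Finset.univ_nonempty
  have hlip := lip_logsum a ha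
  have hcard : (0 : ℝ) < Fintype.card S := by exact_mod_cast Fintype.card_pos
  have hZi : Integrable (fun x : ι → ℝ => ∑ s, Real.exp (∑ p, a s p * x p)) (gpi ι) :=
    integrable_finsetSum _ fun s _ => gauss_exp_int (a s)
  have hA1 : ∫ x, ∑ s, Real.exp (∑ p, a s p * x p) ∂(gpi ι)
      = Fintype.card S * Real.exp (v / 2) := by
    rw [integral_finsetSum _ fun s _ => gauss_exp_int (a s)]
    simp_rw [gauss_exp, hv]
    simp
  have hsq : ∀ x : ι → ℝ, (∑ s, Real.exp (∑ p, a s p * x p)) ^ 2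
      = ∑ s, ∑ t, Real.exp (∑ p, (a s p + a t p) * x p) := by
    intro x
    rw [sq, Finset.sum_mul_sum]
    simp_rw [← Real.exp_add, ← Finset.sum_add_distrib, ← add_mul]
  have hZ2 : Integrable (fun x : ι → ℝ => (∑ s, Real.exp (∑ p, a s p * x p)) ^ 2) (gpi ι) := by
    simp_rw [hsq]
    exact integrable_finsetSum _ fun s _ => integrable_finsetSum _ fun t _ => gauss_exp_int _
  have hA2 : ∫ x, (∑ s, Real.exp (∑ p, a s p * x p)) ^ 2 ∂(gpi ι)
      ≤ C * (Fintype.card S * Real.exp (v / 2)) ^ 2 := by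
    simp_rw [hsq]
    rw [integral_finsetSum _ fun s _ => integrable_finsetSum _ fun t _ => gauss_exp_int _]
    have : ∀ s, ∫ x, ∑ t, Real.exp (∑ p, (a s p + a t p) * x p) ∂(gpi ι)
        = Real.exp v * ∑ t, Real.exp (∑ p, a s p * a t p) := by
      intro s
      rw [integral_finsetSum _ fun t _ => gauss_exp_int _, Finset.mul_sum]
      refine Finset.sum_congr rfl fun t _ => ?_
      rw [gauss_exp, ← Real.exp_add]
      congr 1
      have : ∑ p, (a s p + a t p) ^ 2 = v + v + 2 * ∑ p, a s p * a t p := by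
        nth_rewrite 1 [← hv s]
        rw [← hv t, Finset.mul_sum, ← Finset.sum_add_distrib, ← Finset.sum_add_distrib]
        exact Finset.sum_congr rfl fun p _ => by ring
      rw [this]; ring
    simp_rw [this]
    rw [← Finset.mul_sum]
    calc _ ≤ Real.exp v * (C * (Fintype.card S : ℝ) ^ 2) := by gcongr
      _ = _ := by
        rw [mul_pow, ← Real.exp_nat_mul, show ((2 : ℕ) : ℝ) * (v / 2) = v by push_cast; ring]; ring
  have hlogA : Real.log (Fintype.card S * Real.exp (v / 2))
      = Real.log (Fintype.card S) + v / 2 := by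
    rw [Real.log_mul hcard.ne' (Real.exp_pos _).ne', Real.log_exp]
  rw [← hlogA]
  exact ⟨upper_abs _ _ hpos _ (by positivity) hZi (hlip.memLp.integrable (by norm_num)) hA1,
    lower_abs _ _ hpos _ C _ (by positivity) hC (by positivity) hZi hZ2 hlip.memLp hA1 hA2
      (var_gen _ hlip)⟩

lemma exp_sq_int {b : ℝ} (hb : b < 1) :
    Integrable (fun g : ℝ => Real.exp (b * g ^ 2 / 2)) (gaussianReal 0 1) := by
  rw [gaussianReal_of_var_ne_zero _ one_ne_zero,
    integrable_withDensity_iff (measurable_gaussianPDF 0 1) (ae_of_all _ fun _ => gaussianPDF_lt_top)]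
  simp only [toReal_gaussianPDF, gaussianPDFReal]
  have := (integrable_exp_neg_mul_sq (b := (1 - b) / 2) (by linarith)).const_mul
    (Real.sqrt (2 * Real.pi * (1 : NNReal)))⁻¹
  refine this.congr (ae_of_all _ fun g => ?_)
  simp only
  rw [mul_left_comm, ← Real.exp_add]
  congr 2
  simp
  ring

lemma spin_sq {N : ℕ} (σ : Fin N → Bool) (i : Fin N) : spin σ i * spin σ i = 1 := by
  unfold spin; split_ifs <;> norm_num

lemma spin_abs {N : ℕ} (σ : Fin N → Bool) (i : Fin N) : |spin σ i| = 1 := by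
  unfold spin; split_ifs <;> norm_num

/-- Coefficients of the SK Hamiltonian. -/
noncomputable def skCoef {N : ℕ} (k : ℝ) (σ : Fin N → Bool) (p : Fin N × Fin N) : ℝ :=
  if p.1 ≠ p.2 then k * spin σ p.1 * spin σ p.2 else 0

lemma skCoef_cov {N : ℕ} (k : ℝ) (σ τ : Fin N → Bool) :
    ∑ p, skCoef k σ p * skCoef k τ p
      = k ^ 2 * ((∑ i, spin σ i * spin τ i) ^ 2 - N) := by
  rw [Fintype.sum_prod_type]
  have h : ∀ i j : Fin N, skCoef k σ (i, j) * skCoef k τ (i, j)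
      = k ^ 2 * ((spin σ i * spin τ i) * (spin σ j * spin τ j)) - if i = j then k ^ 2 else 0 := by
    intro i j
    unfold skCoef
    by_cases hij : i = j
    · subst hij
      have h1 := spin_sq σ i
      have h2 := spin_sq τ i
      have : (spin σ i * spin τ i) * (spin σ i * spin τ i) = 1 := by
        calc _ = (spin σ i * spin σ i) * (spin τ i * spin τ i) := by ring
          _ = 1 := by rw [h1, h2, one_mul]
      simp [this]
    · simp [hij]; ring
  simp_rw [h, Finset.sum_sub_distrib, ← Finset.mul_sum, ← Finset.sum_mul]
  simp
  ring

lemma sum_exp_spin {N : ℕ} (σ : Fin N → Bool) (u : ℝ) :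
    ∑ τ : Fin N → Bool, Real.exp (u * ∑ i, spin σ i * spin τ i) = (2 * Real.cosh u) ^ N := by
  have h := Finset.prod_univ_sum (fun _ : Fin N => (Finset.univ : Finset Bool))
    (fun i b => Real.exp (u * (spin σ i * if b then 1 else -1)))
  rw [Fintype.piFinset_univ] at h
  simp_rw [Finset.mul_sum, Real.exp_sum]
  have h2 : ∀ i, ∑ b : Bool, Real.exp (u * (spin σ i * if b then 1 else -1)) = 2 * Real.cosh u := by
    intro i
    unfold spin
    rw [Real.cosh_eq]
    split_ifs <;> simp <;> ring
  simp_rw [h2] at h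
  simp only [Finset.prod_const, Finset.card_univ, Fintype.card_fin] at h
  rw [h]
  rfl

lemma second_moment {N : ℕ} (hN : 0 < N) {β : ℝ} (hb : β ^ 2 < 1) (σ : Fin N → Bool) :
    ∑ τ : Fin N → Bool, Real.exp (β ^ 2 / (2 * N) * (∑ i, spin σ i * spin τ i) ^ 2)
      ≤ (∫ g, Real.exp (β ^ 2 * g ^ 2 / 2) ∂(gaussianReal 0 1)) * 2 ^ N := by
  have hN' : (0 : ℝ) < N := by exact_mod_cast hN
  set θ := β / Real.sqrt N with hθ
  have hθ2 : θ ^ 2 = β ^ 2 / N := by rw [hθ, div_pow, Real.sq_sqrt hN'.le]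
  have h1 : ∀ y : ℝ, Real.exp (β ^ 2 / (2 * N) * y ^ 2)
      = ∫ g, Real.exp ((θ * y) * g) ∂(gaussianReal 0 1) := by
    intro y
    have := congrFun (mgf_fun_id_gaussianReal (μ := 0) (v := 1)) (θ * y)
    simp only [mgf] at this
    rw [this, mul_pow, hθ2]
    congr 1
    simp
    field_simp
  simp_rw [h1]
  rw [← integral_finsetSum _ fun τ _ => integrable_exp_mul_gaussianReal _, ← integral_mul_const]
  refine integral_mono (integrable_finsetSum _ fun τ _ => integrable_exp_mul_gaussianReal _)
    ((exp_sq_int hb).mul_const _) fun g => ?_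
  have h2 : ∀ τ : Fin N → Bool, θ * (∑ i, spin σ i * spin τ i) * g
      = (θ * g) * ∑ i, spin σ i * spin τ i := fun τ => by ring
  simp only [h2, sum_exp_spin, mul_pow]
  rw [mul_comm]
  gcongr
  calc Real.cosh (θ * g) ^ N ≤ Real.exp ((θ * g) ^ 2 / 2) ^ N := by
        gcongr
        exact Real.cosh_le_exp_half_sq _
    _ = Real.exp (β ^ 2 * g ^ 2 / 2) := by
        rw [← Real.exp_nat_mul, mul_pow, hθ2]
        congr 1
        field_simp

/-- high-temperature SK free energy. For `β < 1` and centered i.i.d.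
standard Gaussian couplings, `lim_{N→∞} (1/N) E[log Z_N^SK] = log 2 + β²/4`, where
`Z_N^SK = Σ_σ exp((β/√(2N)) Σ_{i≠j} J_{ij} σ_i σ_j)`. -/
theorem sk_high_temperature_annealed (β : ℝ) (hβ0 : 0 ≤ β) (hβ : β < 1) :
    Tendsto (fun N : ℕ => (1 / (N : ℝ)) *
        ∫ J : Fin N × Fin N → ℝ,
          Real.log (∑ σ : Fin N → Bool, Real.exp
            (∑ p ∈ Finset.univ.filter (fun p : Fin N × Fin N => p.1 ≠ p.2),
              (β / Real.sqrt (2 * (N : ℝ))) * J p * spin σ p.1 * spin σ p.2))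
          ∂(Measure.pi fun _ : Fin N × Fin N => gaussianReal 0 1))
      atTop (𝓝 (Real.log 2 + β ^ 2 / 4)) := by
  have hb : β ^ 2 < 1 := by nlinarith
  set C := ∫ g, Real.exp (β ^ 2 * g ^ 2 / 2) ∂(gaussianReal 0 1) with hCdef
  have hC : 0 < C := integral_exp_pos (exp_sq_int hb)
  have bounds : ∀ N : ℕ, 0 < N →
      (∫ J : Fin N × Fin N → ℝ,
          Real.log (∑ σ : Fin N → Bool, Real.exp
            (∑ p ∈ Finset.univ.filter (fun p : Fin N × Fin N => p.1 ≠ p.2),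
              (β / Real.sqrt (2 * (N : ℝ))) * J p * spin σ p.1 * spin σ p.2))
          ∂(gpi (Fin N × Fin N)) ≤ N * Real.log 2 + β ^ 2 * (N - 1) / 4) ∧
      N * Real.log 2 + β ^ 2 * (N - 1) / 4 - Real.log 2
        - 2 * Real.sqrt (C * β ^ 2 / 2) * Real.sqrt N ≤
      ∫ J : Fin N × Fin N → ℝ,
          Real.log (∑ σ : Fin N → Bool, Real.exp
            (∑ p ∈ Finset.univ.filter (fun p : Fin N × Fin N => p.1 ≠ p.2),
              (β / Real.sqrt (2 * (N : ℝ))) * J p * spin σ p.1 * spin σ p.2))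
          ∂(gpi (Fin N × Fin N)) := by
    intro N hN
    have hN' : (0 : ℝ) < N := by exact_mod_cast hN
    set k := β / Real.sqrt (2 * (N : ℝ)) with hk
    have hk0 : 0 ≤ k := by positivity
    have hk2 : k ^ 2 = β ^ 2 / (2 * N) := by rw [hk, div_pow, Real.sq_sqrt (by positivity)]
    have hH : ∀ (J : Fin N × Fin N → ℝ) (σ : Fin N → Bool),
        ∑ p ∈ Finset.univ.filter (fun p : Fin N × Fin N => p.1 ≠ p.2),
          k * J p * spin σ p.1 * spin σ p.2 = ∑ p, skCoef k σ p * J p := by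
      intro J σ
      rw [Finset.sum_filter]
      refine Finset.sum_congr rfl fun p _ => ?_
      unfold skCoef
      split_ifs
      · ring
      · simp
    simp_rw [hH]
    have h := gauss_bounds (S := Fin N → Bool) (ι := Fin N × Fin N) (c := k)
      (v := β ^ 2 * (N - 1) / 2) hC (skCoef k) ?_ ?_ ?_
    · have hcard : Real.log (Fintype.card (Fin N → Bool)) = N * Real.log 2 := by
        simp
      have hs : Real.sqrt (C * (Fintype.card (Fin N × Fin N) * k ^ 2))
          = Real.sqrt (C * β ^ 2 / 2) * Real.sqrt N := by
        rw [← Real.sqrt_mul (by positivity), hk2]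
        congr 1
        simp
        field_simp
      rw [hcard, hs] at h
      refine ⟨h.1.trans (le_of_eq (by ring)), le_trans (le_of_eq (by ring)) h.2⟩
    · intro σ p
      unfold skCoef
      split_ifs
      · rw [abs_mul, abs_mul, spin_abs, spin_abs, abs_of_nonneg hk0]; simp
      · simpa using hk0
    · intro σ
      simp_rw [sq (skCoef k σ _)]
      rw [skCoef_cov, hk2]
      simp_rw [spin_sq]
      simp
      field_simp
    · have : ∀ σ : Fin N → Bool, ∑ τ, Real.exp (∑ p, skCoef k σ p * skCoef k τ p) ≤ C * 2 ^ N := by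
        intro σ
        refine le_trans (Finset.sum_le_sum fun τ _ => ?_) (second_moment hN hb σ)
        rw [skCoef_cov, hk2]
        refine Real.exp_le_exp.2 ?_
        gcongr
        linarith
      refine (Finset.sum_le_sum fun σ _ => this σ).trans (le_of_eq ?_)
      simp
      ring
  have hinv : Tendsto (fun N : ℕ => 1 / (N : ℝ)) atTop (𝓝 0) := tendsto_one_div_atTop_nhds_zero_nat
  have hsq : Tendsto (fun N : ℕ => Real.sqrt (1 / (N : ℝ))) atTop (𝓝 0) := by
    have h := (Real.continuous_sqrt.tendsto 0).comp hinv
    rw [Real.sqrt_zero] at h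
    exact h
  have hlow : Tendsto (fun N : ℕ => Real.log 2 + β ^ 2 / 4 - (β ^ 2 / 4 + Real.log 2) * (1 / (N : ℝ))
      - 2 * Real.sqrt (C * β ^ 2 / 2) * Real.sqrt (1 / (N : ℝ))) atTop
      (𝓝 (Real.log 2 + β ^ 2 / 4)) := by
    have := ((hinv.const_mul (β ^ 2 / 4 + Real.log 2)).const_sub (Real.log 2 + β ^ 2 / 4)).sub
      (hsq.const_mul (2 * Real.sqrt (C * β ^ 2 / 2)))
    simpa using this
  refine tendsto_of_tendsto_of_tendsto_of_le_of_le' hlow tendsto_const_nhds ?_ ?_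
  · filter_upwards [eventually_gt_atTop 0] with N hN
    have hN' : (0 : ℝ) < N := by exact_mod_cast hN
    refine le_trans (le_of_eq ?_) (mul_le_mul_of_nonneg_left (bounds N hN).2 (by positivity))
    have h1 : Real.sqrt (1 / (N : ℝ)) = 1 / (N : ℝ) * Real.sqrt N := by
      rw [Real.sqrt_div zero_le_one, Real.sqrt_one]
      have h3 := Real.sqrt_pos.2 hN'
      have h4 := Real.mul_self_sqrt hN'.le
      rw [div_eq_iff h3.ne', mul_assoc, h4]
      field_simp
    rw [h1]
    field_simp
    ring
  · filter_upwards [eventually_gt_atTop 0] with N hN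
    have hN' : (0 : ℝ) < N := by exact_mod_cast hN
    refine (mul_le_mul_of_nonneg_left (bounds N hN).1 (by positivity)).trans ?_
    rw [one_div, inv_mul_le_iff₀ hN']
    nlinarith [sq_nonneg β]
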